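/- For every integer p ≥ 1 and every integer i with 0 ≤ i ≤ 2p−1, writing j for the residue of i modulo p, the rational number (11p−2i)²/(4p(10p+1)) − (p−2j)²/(4p) − 4 is strictly negative. -/

import Mathlib

/- For every p ≥ 1 and 0 ≤ i ≤ 2p−1, writing j = i mod p, the quantity
(11p−2i)²/(4p(10p+1)) − (p−2j)²/(4p) − 4 is strictly negative. -/
theorem d_invariant_estimate_case_one (p i : ℤ) (hp : 1 ≤ p)
    (hi0 : 0 ≤ i) (hi1 : i ≤ 2 * p - 1) :
    (11 * (p : ℚ) - 2 * (i : ℚ)) ^ 2 / (4 * (p : ℚ) * (10 * (p : ℚ) + 1))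
      - ((p : ℚ) - 2 * ((i % p : ℤ) : ℚ)) ^ 2 / (4 * (p : ℚ)) - 4 < 0 := by
  have hP : (1 : ℚ) ≤ (p : ℚ) := by exact_mod_cast hp
  have hp0 : (0 : ℚ) < (p : ℚ) := by linarith
  have hq : (0 : ℚ) < 10 * (p : ℚ) + 1 := by linarith
  have key : (11 * (p : ℚ) - 2 * (i : ℚ)) ^ 2
      - (10 * (p : ℚ) + 1) * ((p : ℚ) - 2 * ((i % p : ℤ) : ℚ)) ^ 2
      - 16 * (p : ℚ) * (10 * (p : ℚ) + 1) < 0 := by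
    rcases lt_or_ge i p with h | h
    · rw [Int.emod_eq_of_lt hi0 h]
      have e : (11 * (p : ℚ) - 2 * (i : ℚ)) ^ 2
          - (10 * (p : ℚ) + 1) * ((p : ℚ) - 2 * (i : ℚ)) ^ 2
          - 16 * (p : ℚ) * (10 * (p : ℚ) + 1)
          = -((p : ℚ) * (10 * (2 * (i : ℚ) - (p - 1)) ^ 2 + 60 * p + 6)) := by ring
      rw [e]
      have : 0 < (p : ℚ) * (10 * (2 * (i : ℚ) - (p - 1)) ^ 2 + 60 * p + 6) := by positivity
      linarith
    · have hm : i % p = i - p := by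
        rw [← Int.sub_emod_right i p]
        exact Int.emod_eq_of_lt (by omega) (by omega)
      rw [hm]
      push_cast
      obtain ⟨j, hj⟩ : ∃ j : ℚ, (i : ℚ) = p + j := ⟨i - p, by ring⟩
      rw [hj]
      have e : (11 * (p : ℚ) - 2 * (p + j)) ^ 2
          - (10 * (p : ℚ) + 1) * ((p : ℚ) - 2 * (p + j - p)) ^ 2
          - 16 * (p : ℚ) * (10 * (p : ℚ) + 1)
          = -((p : ℚ) * (10 * (2 * j - (p - 4 / 5)) ^ 2 + 96 * p + 48 / 5)) := by ring
      rw [e]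
      have : 0 < (p : ℚ) * (10 * (2 * j - (p - 4 / 5)) ^ 2 + 96 * p + 48 / 5) := by positivity
      linarith
  have e : (11 * (p : ℚ) - 2 * (i : ℚ)) ^ 2 / (4 * (p : ℚ) * (10 * (p : ℚ) + 1))
      - ((p : ℚ) - 2 * ((i % p : ℤ) : ℚ)) ^ 2 / (4 * (p : ℚ)) - 4
      = ((11 * (p : ℚ) - 2 * (i : ℚ)) ^ 2
      - (10 * (p : ℚ) + 1) * ((p : ℚ) - 2 * ((i % p : ℤ) : ℚ)) ^ 2
      - 16 * (p : ℚ) * (10 * (p : ℚ) + 1)) / (4 * (p : ℚ) * (10 * (p : ℚ) + 1)) := by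
    field_simp
    ring
  rw [e]
  exact div_neg_of_neg_of_pos key (by positivity)
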